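/- arXiv:2108.09787 — 3 statements merged into one kernel-verified Lean document; each statement's English description precedes it below -/
import Mathlib

section
/- Let M be a Malcev algebra over k, V a k-vector space, and ▷ : M×V→V a bilinear map satisfying the left-module condition: [x,z]▷(y▷q) = [[x,y],z]▷q − x▷([y,z]▷q) + y▷(x▷(z▷q)) − z▷(y▷(x▷q)) for all x,y,z ∈ M, q ∈ V. Let ω : M×M→V be an antisymmetric bilinear map and define the bracket [(x,u),(y,v)] = ([x,y], x▷v − y▷u + ω(x,y)) on M⊕V. Then M⊕V with this bracket is a Malcev algebra if and only if for all x,y,z,t ∈ M: ω([x,z],[y,t]) + [t,y]▷ω(x,z) + [x,z]▷ω(y,t) = ω([[x,y],z],t) + ω([[y,z],t],x) + ω([[z,t],x],y) + ω([[t,x],y],z) + x▷(t▷ω(y,z)) − x▷ω([y,z],t) + z▷(y▷ω(t,x)) − z▷ω([t,x],y) + t▷(z▷ω(x,y)) − t▷ω([x,y],z) + y▷(x▷ω(z,t)) − y▷ω([z,t],x). -/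
def IsBilin (k : Type*) [Field k] {A B C : Type*}
    [AddCommGroup A] [Module k A] [AddCommGroup B] [Module k B]
    [AddCommGroup C] [Module k C] (f : A → B → C) : Prop :=
  (∀ (x y : A) (z : B), f (x + y) z = f x z + f y z) ∧
  (∀ (c : k) (x : A) (z : B), f (c • x) z = c • f x z) ∧
  (∀ (x : A) (y z : B), f x (y + z) = f x y + f x z) ∧
  (∀ (c : k) (x : A) (z : B), f x (c • z) = c • f x z)

def jacF {A : Type*} [AddCommGroup A] (br : A → A → A) (x y z : A) : A :=
  br (br x y) z + br (br y z) x + br (br z x) y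

def IsMalcevBracket (k : Type*) [Field k] {A : Type*} [AddCommGroup A] [Module k A]
    (br : A → A → A) : Prop :=
  IsBilin k br ∧ (∀ x y : A, br x y = - br y x) ∧
  (∀ x y z : A, jacF br x y (br x z) = br (jacF br x y z) x)

namespace IsBilin

variable {k A B C : Type*} [Field k] [AddCommGroup A] [Module k A] [AddCommGroup B] [Module k B]
  [AddCommGroup C] [Module k C] {f : A → B → C}

lemma neg_left (hf : IsBilin k f) (x : A) (y : B) : f (-x) y = -f x y := by
  simpa using hf.2.1 (-1) x y

lemma neg_right (hf : IsBilin k f) (x : A) (y : B) : f x (-y) = -f x y := by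
  simpa using hf.2.2.2 (-1) x y

lemma zero_right (hf : IsBilin k f) (x : A) : f x 0 = 0 := by
  simpa using hf.2.2.2 0 x 0

lemma sub_right (hf : IsBilin k f) (x : A) (y z : B) : f x (y - z) = f x y - f x z := by
  rw [sub_eq_add_neg, hf.2.2.1, hf.neg_right, sub_eq_add_neg]

end IsBilin

section Sagle

variable {k A : Type*} [Field k] [AddCommGroup A] [Module k A] {br : A → A → A}

/-- The difference of the two sides of the Sagle identity. -/
def sagleDefect (br : A → A → A) (x y z t : A) : A :=
  br (br x z) (br y t) -
    (br (br (br x y) z) t + br (br (br y z) t) x + br (br (br z t) x) y + br (br (br t x) y) z)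

lemma sagleDefect_cyclic (hb : IsBilin k br) (ha : ∀ x y, br x y = -br y x) (x y z t : A) :
    sagleDefect br y z t x = sagleDefect br x y z t := by
  have h : br (br y t) (br z x) = br (br x z) (br y t) := by
    rw [ha (br y t), ha z x, hb.neg_left, neg_neg]
  rw [sagleDefect, sagleDefect, h]
  abel

lemma sagleDefect_self (h2 : (2 : k) ≠ 0) (hb : IsBilin k br) (ha : ∀ x y, br x y = -br y x)
    (x y z : A) :
    sagleDefect br x y z x = jacF br x y (br x z) - br (jacF br x y z) x := by
  have : br x x = 0 := by
    have h : (2 : k) • br x x = 0 := by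
      rw [two_smul]
      nth_rewrite 1 [ha x x]
      exact neg_add_cancel _
    exact (smul_eq_zero.mp h).resolve_left h2
  have hz : ∀ u, br 0 u = 0 := fun u => by simpa using hb.2.1 0 0 u
  have e₁ : br (br x z) (br y x) = br (br x y) (br x z) := by
    rw [ha (br x z), ha y x, hb.neg_left, neg_neg]
  have e₂ : br y (br x z) = br (br z x) y := by
    rw [ha y, ha x z, hb.neg_left, neg_neg]
  have e₃ : br (br (br x z) x) y = -br (br (br z x) x) y := by
    rw [ha x z, hb.neg_left, hb.neg_left]
  simp only [sagleDefect, jacF, this, hz, e₁, e₂, e₃, hb.1]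
  abel

lemma sagleDefect_swap_outer (hb : IsBilin k br) (h : ∀ x y z, sagleDefect br x y z x = 0)
    (x y z t : A) : sagleDefect br x y z t = -sagleDefect br t y z x := by
  have h₁ := h (x + t) y z
  have h₂ := h x y z
  have h₃ := h t y z
  simp only [sagleDefect, hb.1, hb.2.2.1] at *
  linear_combination (norm := module) h₁ - h₂ - h₃

/-- Away from characteristic two, the Malcev identity is equivalent to the Sagle identity. -/
lemma malcev_identity_iff_sagle (h2 : (2 : k) ≠ 0) (hb : IsBilin k br)
    (ha : ∀ x y, br x y = -br y x) :
    (∀ x y z, jacF br x y (br x z) = br (jacF br x y z) x) ↔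
      ∀ x y z t, sagleDefect br x y z t = 0 := by
  refine ⟨fun h x y z t => ?_, fun h x y z => ?_⟩
  · have hself : ∀ x y z, sagleDefect br x y z x = 0 := fun x y z => by
      rw [sagleDefect_self h2 hb ha, h, sub_self]
    have hcyc := sagleDefect_cyclic hb ha
    have hout := sagleDefect_swap_outer hb hself
    have hlast : ∀ x y z t, sagleDefect br x y z t = -sagleDefect br x y t z :=
      fun x y z t => by
        rw [← hcyc, ← hcyc, ← hcyc, hout, hcyc, hcyc, hcyc]
    have hmid : ∀ x y z t, sagleDefect br x y z t = -sagleDefect br x z y t :=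
      fun x y z t => by
        rw [← hcyc, ← hcyc, hout, hcyc, hcyc]
    have hfirst : ∀ x y z t, sagleDefect br x y z t = -sagleDefect br y x z t :=
      fun x y z t => by
        rw [← hcyc, hout, hcyc]
    -- The cyclic shift is an odd permutation, so the defect equals its own negative.
    have hneg : sagleDefect br x y z t = -sagleDefect br x y z t := by
      conv_lhs => rw [hfirst, hmid, hlast, hcyc, neg_neg]
    have h' : (2 : k) • sagleDefect br x y z t = 0 := by
      rw [two_smul]
      nth_rewrite 1 [hneg]
      exact neg_add_cancel _
    exact (smul_eq_zero.mp h').resolve_left h2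
  · rw [← sub_eq_zero, ← sagleDefect_self h2 hb ha, h]

end Sagle

theorem stmt2 {k : Type*} [Field k] (h2 : (2 : k) ≠ 0) (h3 : (3 : k) ≠ 0) {M V : Type*} [AddCommGroup M] [Module k M] [AddCommGroup V] [Module k V]
    (bm : M → M → M) (hbm : IsMalcevBracket k bm)
    (tr : M → V → V) (htr : IsBilin k tr)
    (hmod : ∀ (x y z : M) (q : V),
      tr (bm x z) (tr y q) =
      tr (bm (bm x y) z) q - tr x (tr (bm y z) q)
      + tr y (tr x (tr z q)) - tr z (tr y (tr x q)))
    (om : M → M → V) (hom : IsBilin k om) (homa : ∀ x y : M, om x y = - om y x) :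
    IsMalcevBracket k
      (fun p q : M × V => (bm p.1 q.1, tr p.1 q.2 - tr q.1 p.2 + om p.1 q.1)) ↔
    (∀ x y z t : M,
      om (bm x z) (bm y t) + tr (bm t y) (om x z) + tr (bm x z) (om y t) =
        om (bm (bm x y) z) t + om (bm (bm y z) t) x + om (bm (bm z t) x) y + om (bm (bm t x) y) z
        + tr x (tr t (om y z)) - tr x (om (bm y z) t)
        + tr z (tr y (om t x)) - tr z (om (bm t x) y)
        + tr t (tr z (om x y)) - tr t (om (bm x y) z)
        + tr y (tr x (om z t)) - tr y (om (bm z t) x)) := by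
  obtain ⟨hb, ha, hj⟩ := hbm
  have hB : IsBilin k
      (fun p q : M × V => (bm p.1 q.1, tr p.1 q.2 - tr q.1 p.2 + om p.1 q.1)) := by
    refine ⟨fun p q r => ?_, fun c p q => ?_, fun p q r => ?_, fun c p q => ?_⟩ <;>
      ext <;>
      simp only [Prod.fst_add, Prod.snd_add, Prod.smul_fst, Prod.smul_snd, hb.1, hb.2.1,
        hb.2.2.1, hb.2.2.2, htr.1, htr.2.1, htr.2.2.1, htr.2.2.2, hom.1, hom.2.1, hom.2.2.1,
        hom.2.2.2] <;>
      module
  have hA : ∀ p q : M × V, ((bm p.1 q.1, tr p.1 q.2 - tr q.1 p.2 + om p.1 q.1) : M × V) =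
      -(bm q.1 p.1, tr q.1 p.2 - tr p.1 q.2 + om q.1 p.1) := by
    intro p q
    ext
    · exact ha _ _
    · simp only [Prod.snd_neg, homa p.1 q.1]
      abel
  have htn : ∀ x y v, tr (bm x y) v = -tr (bm y x) v := fun x y v => by
    rw [ha x y, htr.neg_left]
  have hS := (malcev_identity_iff_sagle h2 hb ha).mp hj
  rw [IsMalcevBracket, and_iff_right hB, and_iff_right hA, malcev_identity_iff_sagle h2 hB hA]
  refine ⟨fun h x y z t => ?_, fun h p q r s => Prod.ext (hS p.1 q.1 r.1 s.1) ?_⟩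
  · have e := congrArg Prod.snd (h (x, 0) (y, 0) (z, 0) (t, 0))
    simp only [sagleDefect, Prod.snd_sub, Prod.snd_add, Prod.snd_zero, htr.zero_right,
      htr.2.2.1, htr.sub_right] at e
    linear_combination (norm := module) e + htn t y (om x z)
  · obtain ⟨x, a⟩ := p
    obtain ⟨y, b⟩ := q
    obtain ⟨z, c⟩ := r
    obtain ⟨t, d⟩ := s
    simp only [sagleDefect, Prod.snd_sub, Prod.snd_add, Prod.snd_zero,
      htr.2.2.1, htr.sub_right]
    linear_combination (norm := module) h x y z t - htn t y (om x z) + hmod x y z d + hmod t x y c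
      - htn t y (tr x c) + hmod z t x b - htn z x (tr t b) + hmod y z t a
end

section
/- Let M be a Malcev algebra over k, V a k-vector space, and let an extending datum (⊲,▷,ω,{·,·}) be given such that the unified product bracket on M⊕V is a Malcev algebra bracket. Then for all x,y ∈ M and p,q ∈ V: [x⊲p, y⊲q] + (x⊲p)⊲(y▷q) − (y⊲q)⊲(x▷p) + ω(x▷p, y▷q) = ([x,y]⊲p)⊲q + ω([x,y]▷p, q) + [(y⊲p)⊲q, x] + [ω(y▷p,q), x] − x⊲((y⊲p)▷q) − x⊲{y▷p, q} + [[ω(p,q),x],y] − [x⊲{p,q}, y] + y⊲(x▷{p,q}) − [x⊲q,y]⊲p + (y⊲(x▷q))⊲p + ω(y▷(x▷q), p). -/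
def ubr {M V : Type*} [AddCommGroup M] [AddCommGroup V]
    (bm : M → M → M) (tl : M → V → M) (tr : M → V → V)
    (om : V → V → M) (bv : V → V → V) :
    M × V → M × V → M × V :=
  fun p q =>
    (bm p.1 q.1 + tl p.1 q.2 - tl q.1 p.2 + om p.2 q.2,
     tr p.1 q.2 - tr q.1 p.2 + bv p.2 q.2)

theorem IsBilin.zero_left {k : Type*} [Field k] {A B C : Type*}
    [AddCommGroup A] [Module k A] [AddCommGroup B] [Module k B]
    [AddCommGroup C] [Module k C] {f : A → B → C} (hf : IsBilin k f) (z : B) :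
    f 0 z = 0 := by
  simpa using hf.2.1 0 0 z

theorem IsBilin.zero_right_s5 {k : Type*} [Field k] {A B C : Type*}
    [AddCommGroup A] [Module k A] [AddCommGroup B] [Module k B]
    [AddCommGroup C] [Module k C] {f : A → B → C} (hf : IsBilin k f) (x : A) :
    f x 0 = 0 := by
  simpa using hf.2.2.2 0 x 0

theorem IsBilin.neg_left_s5 {k : Type*} [Field k] {A B C : Type*}
    [AddCommGroup A] [Module k A] [AddCommGroup B] [Module k B]
    [AddCommGroup C] [Module k C] {f : A → B → C} (hf : IsBilin k f) (x : A) (z : B) :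
    f (-x) z = -f x z := by
  simpa using hf.2.1 (-1) x z

theorem IsBilin.neg_right_s5 {k : Type*} [Field k] {A B C : Type*}
    [AddCommGroup A] [Module k A] [AddCommGroup B] [Module k B]
    [AddCommGroup C] [Module k C] {f : A → B → C} (hf : IsBilin k f) (x : A) (z : B) :
    f x (-z) = -f x z := by
  simpa using hf.2.2.2 (-1) x z

/-- The Malcev identity, linearized in its repeated variable. -/
theorem IsMalcevBracket.linearized {k : Type*} [Field k] {A : Type*} [AddCommGroup A]
    [Module k A] {br : A → A → A} (h : IsMalcevBracket k br) (x w y z : A) :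
    jacF br x y (br w z) + jacF br w y (br x z) =
      br (jacF br x y z) w + br (jacF br w y z) x := by
  obtain ⟨⟨hadd, -, hadd', -⟩, -, hM⟩ := h
  have hxw := hM (x + w) y z
  have hx := hM x y z
  have hw := hM w y z
  simp only [jacF, hadd, hadd'] at hxw hx hw ⊢
  linear_combination (norm := module) hxw - hx - hw

/-- Sagle's identity, equivalent to the Malcev identity in characteristic different from two. -/
theorem IsMalcevBracket.sagle {k : Type*} [Field k] (h2 : (2 : k) ≠ 0) {A : Type*}
    [AddCommGroup A] [Module k A] {br : A → A → A} (h : IsMalcevBracket k br) (x y z t : A) :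
    br (br x z) (br y t) =
      br (br (br x y) z) t + br (br (br y z) t) x + br (br (br z t) x) y
        + br (br (br t x) y) z := by
  have e₁ := h.linearized x y t z
  have e₂ := h.linearized z x y t
  have e₃ := h.linearized z x t y
  have e₄ := h.linearized z t x y
  obtain ⟨hbil, hanti, -⟩ := h
  have hneg := hbil.neg_left_s5
  have hneg' := hbil.neg_right_s5
  have hadd := hbil.1
  have hx (a b : A) : br x (br a b) = -br (br a b) x := hanti _ _
  have hy (a b : A) : br y (br a b) = -br (br a b) y := hanti _ _
  have ht (a b : A) : br t (br a b) = -br (br a b) t := hanti _ _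
  simp only [jacF, hadd, hneg, hneg', hx, hy, ht, hanti y x, hanti z x, hanti t x,
    hanti z y, hanti t y, hanti t z, hanti (br z t) (br x y), hanti (br y t) (br x z),
    hanti (br y z) (br x t)] at e₁ e₂ e₃ e₄ ⊢
  refine smul_right_injective A h2 ?_
  change (2 : k) • _ = (2 : k) • _
  linear_combination (norm := module) -e₁ - e₂ - e₃ + e₄

theorem stmt5 {k : Type*} [Field k] (h2 : (2 : k) ≠ 0) (h3 : (3 : k) ≠ 0) {M V : Type*} [AddCommGroup M] [Module k M] [AddCommGroup V] [Module k V]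
    (bm : M → M → M) (hbm : IsMalcevBracket k bm)
    (tl : M → V → M) (htl : IsBilin k tl)
    (tr : M → V → V) (htr : IsBilin k tr)
    (om : V → V → M) (hom : IsBilin k om) (homa : ∀ u v : V, om u v = - om v u)
    (bv : V → V → V) (hbv : IsBilin k bv) (hbva : ∀ u v : V, bv u v = - bv v u)
    (huni : IsMalcevBracket k (ubr bm tl tr om bv)) :
    ∀ (x y : M) (p q : V),
      bm (tl x p) (tl y q) + tl (tl x p) (tr y q) - tl (tl y q) (tr x p) + om (tr x p) (tr y q) =
      tl (tl (bm x y) p) q + om (tr (bm x y) p) q + bm (tl (tl y p) q) x + bm (om (tr y p) q) x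
      - tl x (tr (tl y p) q) - tl x (bv (tr y p) q)
      + bm (bm (om p q) x) y - bm (tl x (bv p q)) y + tl y (tr x (bv p q))
      - tl (bm (tl x q) y) p + tl (tl y (tr x q)) p + om (tr y (tr x q)) p := by
  intro x y p q
  have hsagle := congrArg Prod.fst (huni.sagle h2 (x, 0) (y, 0) (0, p) (0, q))
  simp only [ubr, Prod.fst_add, hbm.1.zero_left, hbm.1.zero_right_s5, htl.zero_left, htl.zero_right_s5,
    htr.zero_left, htr.zero_right_s5, hom.zero_left, hom.zero_right_s5, hbv.zero_left, hbv.zero_right_s5,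
    add_zero, zero_add, sub_eq_add_neg, neg_zero, neg_neg,
    hbm.1.1, htl.1, htl.2.2.1, htr.1, htr.2.2.1, hbm.1.neg_left_s5, htl.neg_left_s5, htl.neg_right_s5,
    htr.neg_right_s5] at hsagle
  linear_combination (norm := module) hsagle
end

section
/- Let M be a Malcev algebra over k, V a k-vector space, and let an extending datum (⊲,▷,ω,{·,·}) be given such that the unified product bracket on M⊕V is a Malcev algebra bracket. Then for all u,p,v,q ∈ V: [ω(u,p), ω(v,q)] + ω(u,p)⊲{v,q} − ω(v,q)⊲{u,p} + ω({u,p},{v,q}) = (ω(u,v)⊲p)⊲q + ω({u,v},p)⊲q + ω({{u,v},p}, q) + ω(ω(u,v)▷p, q) + (ω(v,p)⊲q)⊲u + ω({v,p},q)⊲u + ω({{v,p},q}, u) + ω(ω(v,p)▷q, u) + (ω(p,q)⊲u)⊲v + ω({p,q},u)⊲v + ω({{p,q},u}, v) + ω(ω(p,q)▷u, v) + (ω(q,u)⊲v)⊲p + ω({q,u},v)⊲p + ω({{q,u},v}, p) + ω(ω(q,u)▷v, p). -/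
namespace IsMalcevBracket

variable {k A : Type*} [Field k] [AddCommGroup A] [Module k A] {br : A → A → A}

/-- The linearization of the Malcev identity in its repeated variable. -/
theorem linearized_s9 (h : IsMalcevBracket k br) (x y w z : A) :
    jacF br x y (br w z) + jacF br w y (br x z) =
      br (jacF br x y z) w + br (jacF br w y z) x := by
  obtain ⟨⟨hl, -, hr, -⟩, -, hm⟩ := h
  have hx := hm x y z
  have hw := hm w y z
  have hxw := hm (x + w) y z
  simp only [jacF, hl, hr] at hx hw hxw ⊢
  linear_combination (norm := abel) hxw - hx - hw

/-- Sagle's identity holds in every Malcev algebra of characteristic different from two. -/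
theorem sagle_s9 (h : IsMalcevBracket k br) (h2 : (2 : k) ≠ 0) (x y z t : A) :
    br (br x z) (br y t) =
      br (br (br x y) z) t + br (br (br y z) t) x + br (br (br z t) x) y
        + br (br (br t x) y) z := by
  have hxy := h.linearized_s9 x y z t
  have hyt := h.linearized_s9 y t z x
  have hzx := h.linearized_s9 z x t y
  obtain ⟨⟨hl, -, hr, -⟩, ha, -⟩ := h
  have hn (a b : A) : br (-a) b = -br a b :=
    map_neg (AddMonoidHom.mk' (fun a => br a b) fun a a' => hl a a' b) a
  have hn' (a b : A) : br a (-b) = -br a b :=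
    map_neg (AddMonoidHom.mk' (br a) (hr a)) b
  refine smul_right_injective A h2 ?_
  simp only [two_smul, jacF, hl, ha y x, ha z x, ha t x, ha z y, ha t y, ha t z, hn, hn',
    ha x (br _ _), ha y (br _ _), ha t (br _ _),
    ha (br y z) (br x t), ha (br z t) (br x y), ha (br y t) (br x z)] at hxy hyt hzx ⊢
  linear_combination (norm := abel) hyt + hzx - hxy

end IsMalcevBracket

theorem stmt9 {k : Type*} [Field k] (h2 : (2 : k) ≠ 0) (h3 : (3 : k) ≠ 0) {M V : Type*} [AddCommGroup M] [Module k M] [AddCommGroup V] [Module k V]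
    (bm : M → M → M) (hbm : IsMalcevBracket k bm)
    (tl : M → V → M) (htl : IsBilin k tl)
    (tr : M → V → V) (htr : IsBilin k tr)
    (om : V → V → M) (hom : IsBilin k om) (homa : ∀ u v : V, om u v = - om v u)
    (bv : V → V → V) (hbv : IsBilin k bv) (hbva : ∀ u v : V, bv u v = - bv v u)
    (huni : IsMalcevBracket k (ubr bm tl tr om bv)) :
    ∀ (u p v q : V),
      bm (om u p) (om v q) + tl (om u p) (bv v q) - tl (om v q) (bv u p) + om (bv u p) (bv v q) =
      tl (tl (om u v) p) q + tl (om (bv u v) p) q + om (bv (bv u v) p) q + om (tr (om u v) p) q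
      + tl (tl (om v p) q) u + tl (om (bv v p) q) u + om (bv (bv v p) q) u + om (tr (om v p) q) u
      + tl (tl (om p q) u) v + tl (om (bv p q) u) v + om (bv (bv p q) u) v + om (tr (om p q) u) v
      + tl (tl (om q u) v) p + tl (om (bv q u) v) p + om (bv (bv q u) v) p + om (tr (om q u) v) p := by
  intro u p v q
  have htl0 (a : V) : tl 0 a = 0 := by simpa using htl.2.1 0 0 a
  have htr0 (a : V) : tr 0 a = 0 := by simpa using htr.2.1 0 0 a
  have hbm0 (a : M) : bm a 0 = 0 := by simpa using hbm.1.2.2.2 0 a 0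
  have hs := congrArg Prod.fst (huni.sagle_s9 h2 (0, u) (0, v) (0, p) (0, q))
  simp only [ubr, htl0, htr0, hbm0, Prod.fst_add, htl.1, hom.1, add_zero, zero_add,
    sub_zero] at hs
  rw [hs]
  abel
end
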